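/- Let S be a finite set of prime numbers each congruent to 1 mod 4, and let Σ = {2} ∪ {primes p ≡ 3 mod 4} ∪ S. Define f(n) = 2^{ω(n)} if n is squarefree and no prime factor of n lies in Σ, and f(n) = 0 otherwise, where ω(n) is the number of distinct prime factors of n. Then the limit C = lim_{T→∞} ∏_{primes p ≤ T} (1 + f(p)/p)(1 − 1/p) exists, and for every ε with 0 < ε < 1, ∑_{1 ≤ n ≤ Y} f(n) = C·Y + O(Y/(log Y)^{1−ε}) as Y → ∞. -/

import Mathlib

open Filter Asymptotics

noncomputable section

/-- For `S` a finite set of primes, `fSigma S n = 2^{ω(n)}` if `n` is squarefree and no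
prime factor of `n` lies in `Σ = {2} ∪ {primes ≡ 3 mod 4} ∪ S`, and `0` otherwise. -/
def fSigma (S : Finset ℕ) (n : ℕ) : ℝ := by
  classical
  exact if Squarefree n ∧
      ∀ p : ℕ, p.Prime → p ∣ n → ¬(p = 2 ∨ (p.Prime ∧ p % 4 = 3) ∨ p ∈ S) then
    2 ^ n.primeFactors.card
  else 0

/-! ## Abel summation bound -/

lemma aux_abel (a w : ℕ → ℝ) (B : ℝ) (hB : ∀ n, |∑ i ∈ Finset.range n, a i| ≤ B) (M N : ℕ)
    (hMN : M ≤ N) (hw : ∀ i, M ≤ i → w (i + 1) ≤ w i) (h0 : ∀ i, M ≤ i → 0 ≤ w i) :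
    |∑ i ∈ Finset.Ico M N, a i * w i| ≤ 2 * B * w M := by
  have key : |∑ i ∈ Finset.Ico M N, a i * w i - (∑ i ∈ Finset.range N, a i) * w N
      + (∑ i ∈ Finset.range M, a i) * w M| ≤ B * (w M - w N) := by
    induction N, hMN using Nat.le_induction with
    | base => simp
    | succ N hN ih =>
      rw [Finset.sum_Ico_succ_top hN]
      set A := ∑ i ∈ Finset.range (N + 1), a i with hA
      have e : a N = A - ∑ i ∈ Finset.range N, a i := by
        rw [hA, Finset.sum_range_succ]; ring
      have h1 : |A * (w N - w (N + 1))| ≤ B * (w N - w (N + 1)) := by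
        rw [abs_mul, abs_of_nonneg (sub_nonneg.2 (hw N hN))]
        exact mul_le_mul_of_nonneg_right (hB _) (sub_nonneg.2 (hw N hN))
      calc _ = |(∑ i ∈ Finset.Ico M N, a i * w i - (∑ i ∈ Finset.range N, a i) * w N
      + (∑ i ∈ Finset.range M, a i) * w M) + A * (w N - w (N + 1))| := by rw [e]; congr 1; ring
        _ ≤ _ := abs_add_le _ _
        _ ≤ B * (w M - w N) + B * (w N - w (N + 1)) := add_le_add ih h1
        _ = _ := by ring
  have h1 : |(∑ i ∈ Finset.range N, a i) * w N| ≤ B * w N := by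
    rw [abs_mul, abs_of_nonneg (h0 N hMN)]
    exact mul_le_mul_of_nonneg_right (hB _) (h0 N hMN)
  have h2 : |(∑ i ∈ Finset.range M, a i) * w M| ≤ B * w M := by
    rw [abs_mul, abs_of_nonneg (h0 M le_rfl)]
    exact mul_le_mul_of_nonneg_right (hB _) (h0 M le_rfl)
  rw [abs_le] at *
  constructor <;> nlinarith [key.1, key.2, h1.1, h1.2, h2.1, h2.2]

/-! ## The character -/

/-- The nontrivial character mod 4, real-valued. -/
def chi (n : ℕ) : ℝ := ((ZMod.χ₄ (n : ZMod 4) : ℤ) : ℝ)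

lemma chi_eq (n : ℕ) : chi n = if n % 2 = 0 then 0 else if n % 4 = 1 then 1 else -1 := by
  rw [chi, ZMod.χ₄_nat_eq_if_mod_four]
  split_ifs <;> simp

lemma chi_mul (m n : ℕ) : chi (m * n) = chi m * chi n := by
  rw [chi, chi, chi, Nat.cast_mul, map_mul, Int.cast_mul]

lemma chi_one : chi 1 = 1 := by simp [chi_eq]

lemma chi_zero : chi 0 = 0 := by simp [chi_eq]

lemma abs_chi_le (n : ℕ) : |chi n| ≤ 1 := by
  rw [chi_eq]; split_ifs <;> simp

lemma sum_chi (n : ℕ) : ∑ i ∈ Finset.range n, chi i = if n % 4 = 2 ∨ n % 4 = 3 then 1 else 0 := by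
  induction n with
  | zero => simp
  | succ n ih =>
    rw [Finset.sum_range_succ, ih, chi_eq]
    have : n % 4 = 0 ∨ n % 4 = 1 ∨ n % 4 = 2 ∨ n % 4 = 3 := by omega
    rcases this with h | h | h | h
    · have h2 : n % 2 = 0 := by omega
      have h3 : (n + 1) % 4 = 1 := by omega
      simp [h, h2, h3]
    · have h2 : n % 2 = 1 := by omega
      have h3 : (n + 1) % 4 = 2 := by omega
      simp [h, h2, h3]
    · have h2 : n % 2 = 0 := by omega
      have h3 : (n + 1) % 4 = 3 := by omega
      simp [h, h2, h3]
    · have h2 : n % 2 = 1 := by omega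
      have h3 : (n + 1) % 4 = 0 := by omega
      simp [h, h2, h3]

lemma abs_sum_chi_le (n : ℕ) : |∑ i ∈ Finset.range n, chi i| ≤ 1 := by
  rw [sum_chi]; split_ifs <;> simp

/-- Partial sums of the L-series. -/
def Lpart (s : ℝ) (N : ℕ) : ℝ := ∑ i ∈ Finset.range N, chi i * (i : ℝ) ^ (-s)

lemma Lpart_tail (s : ℝ) (hs : 1 ≤ s) (M N : ℕ) (hM : 1 ≤ M) (hMN : M ≤ N) :
    |Lpart s N - Lpart s M| ≤ 2 / M := by
  have h := aux_abel chi (fun i => (i : ℝ) ^ (-s)) 1 abs_sum_chi_le M N hMN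
    (fun i hi => by
      apply Real.rpow_le_rpow_of_nonpos
      · exact_mod_cast (by omega : 0 < i)
      · push_cast; linarith
      · linarith)
    (fun i _ => by positivity)
  have e : Lpart s N - Lpart s M = ∑ i ∈ Finset.Ico M N, chi i * (i : ℝ) ^ (-s) := by
    rw [Finset.sum_Ico_eq_sub _ hMN]; rfl
  rw [e]
  refine h.trans ?_
  have : (M : ℝ) ^ (-s) ≤ (M : ℝ) ^ (-1 : ℝ) :=
    Real.rpow_le_rpow_of_exponent_le (by exact_mod_cast hM) (by linarith)
  rw [Real.rpow_neg_one] at this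
  rw [div_eq_mul_inv]
  linarith

lemma exists_L (s : ℝ) (hs : 1 ≤ s) : ∃ l, Tendsto (Lpart s) atTop (nhds l) := by
  apply cauchySeq_tendsto_of_complete
  apply cauchySeq_of_le_tendsto_0' (fun n : ℕ => 2 / (n : ℝ) + if n = 0 then 4 * |Lpart s 1 - Lpart s 0| + 4 else 0)
  · intro n m hnm
    rw [dist_comm, Real.dist_eq]
    by_cases hn : n = 0
    · subst hn
      rcases Nat.eq_zero_or_pos m with rfl | hm
      · simp; positivity
      · have := Lpart_tail s hs 1 m le_rfl hm
        have h2 := abs_sub_le (Lpart s m) (Lpart s 1) (Lpart s 0)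
        simp at this ⊢
        have := abs_nonneg (Lpart s 1 - Lpart s 0)
        linarith
    · simp only [hn, if_false, add_zero]
      exact Lpart_tail s hs n m (by omega) hnm
  · have h1 : Tendsto (fun n : ℕ => 2 / (n : ℝ)) atTop (nhds 0) := tendsto_const_div_atTop_nhds_zero_nat 2
    refine h1.congr' ?_
    filter_upwards [eventually_gt_atTop 0] with n hn
    simp [hn.ne']

/-- The (conditionally convergent) L-value. -/
def Lval (s : ℝ) : ℝ := limUnder atTop (Lpart s)

lemma Lval_tendsto (s : ℝ) (hs : 1 ≤ s) : Tendsto (Lpart s) atTop (nhds (Lval s)) :=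
  tendsto_nhds_limUnder (exists_L s hs)

lemma Lval_tail (s : ℝ) (hs : 1 ≤ s) (M : ℕ) (hM : 1 ≤ M) : |Lval s - Lpart s M| ≤ 2 / M := by
  have h : Tendsto (fun N => |Lpart s N - Lpart s M|) atTop (nhds |Lval s - Lpart s M|) :=
    ((Lval_tendsto s hs).sub_const _).abs
  refine le_of_tendsto h ?_
  filter_upwards [eventually_ge_atTop M] with N hN
  exact Lpart_tail s hs M N hM hN

lemma Lpart_continuous (N : ℕ) : Continuous (fun s => Lpart s N) := by
  unfold Lpart
  refine continuous_finsetSum _ fun i _ => ?_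
  rcases Nat.eq_zero_or_pos i with rfl | hi
  · simp [chi_zero]; exact continuous_const
  · refine continuous_const.mul ?_
    exact Continuous.rpow continuous_const continuous_neg (fun s => Or.inl (by positivity))

lemma Lval_continuousOn : ContinuousOn Lval (Set.Ici 1) := by
  have : TendstoUniformlyOn (fun N s => Lpart s N) Lval atTop (Set.Ici 1) := by
    rw [Metric.tendstoUniformlyOn_iff]
    intro ε hε
    have h1 : Tendsto (fun n : ℕ => 2 / (n : ℝ)) atTop (nhds 0) := tendsto_const_div_atTop_nhds_zero_nat 2
    filter_upwards [h1.eventually_lt_const hε, eventually_ge_atTop 1] with N hN h1N s hs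
    rw [Real.dist_eq]
    exact (Lval_tail s hs N h1N).trans_lt hN
  exact this.continuousOn (Frequently.of_forall fun N => (Lpart_continuous N).continuousOn)

lemma Lval_one : Lval 1 = Real.pi / 4 := by
  have h1 := (Lval_tendsto 1 le_rfl).comp (tendsto_id.const_mul_atTop' (show 0 < 2 by norm_num))
  refine tendsto_nhds_unique h1 ?_
  refine Real.tendsto_sum_pi_div_four.congr fun k => ?_
  simp only [Function.comp, id, Lpart]
  induction k with
  | zero => simp
  | succ k ih =>
    rw [Finset.sum_range_succ, ih, show 2 * (k + 1) = 2 * k + 1 + 1 by ring,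
      Finset.sum_range_succ, Finset.sum_range_succ]
    have e1 : chi (2 * k) = 0 := by simp [chi_eq]
    have e2 : chi (2 * k + 1) = (-1) ^ k := by
      rw [chi, ZMod.χ₄_eq_neg_one_pow (by omega)]
      push_cast
      congr 1; omega
    simp only [e1, e2, Real.rpow_neg_one]
    push_cast
    ring

lemma Lval_one_pos : 0 < Lval 1 := by rw [Lval_one]; positivity

lemma Lpart_one_Ioc (N : ℕ) : Lpart 1 (N + 1) = ∑ i ∈ Finset.Ioc 0 N, chi i / i := by
  rw [Lpart, Finset.range_eq_Ico, Finset.sum_eq_sum_Ico_succ_bot (by omega)]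
  simp only [chi_zero, zero_mul, zero_add]
  refine Finset.sum_congr ?_ fun i _ => by rw [Real.rpow_neg_one]; rfl
  ext; simp; omega

/-! ## Mertens-type bound for the character -/

open ArithmeticFunction in
/-- `n ↦ χ(n) Λ(n) / n`. -/
def chiLam : ArithmeticFunction ℝ := ⟨fun n => chi n * vonMangoldt n / n, by simp⟩

/-- `n ↦ χ(n) / n`. -/
def chiDiv : ArithmeticFunction ℝ := ⟨fun n => chi n / n, by simp⟩

lemma chiLam_apply (n : ℕ) : chiLam n = chi n * ArithmeticFunction.vonMangoldt n / n := rfl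
lemma chiDiv_apply (n : ℕ) : chiDiv n = chi n / n := rfl

lemma chiLam_mul_chiDiv (n : ℕ) : (chiLam * chiDiv) n = chi n * (Real.log n / n) := by
  rw [ArithmeticFunction.mul_apply]
  rw [← ArithmeticFunction.vonMangoldt_sum, 
    ← Nat.sum_divisorsAntidiagonal (fun i _ => ArithmeticFunction.vonMangoldt i),
    Finset.sum_div, Finset.mul_sum]
  refine Finset.sum_congr rfl fun x hx => ?_
  obtain ⟨hx1, hx2⟩ := Nat.mem_divisorsAntidiagonal.1 hx
  have h1 : (x.1 : ℝ) ≠ 0 := by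
    rintro h; apply hx2; rw [← hx1]; simp at h; simp [h]
  have h2 : (x.2 : ℝ) ≠ 0 := by
    rintro h; apply hx2; rw [← hx1]; simp at h; simp [h]
  rw [chiLam_apply, chiDiv_apply, ← hx1, chi_mul]
  push_cast
  field_simp

lemma abs_sum_chi_log (N : ℕ) : |∑ n ∈ Finset.Ioc 0 N, chi n * (Real.log n / n)| ≤ 2 := by
  have e : ∑ n ∈ Finset.Ioc 0 N, chi n * (Real.log n / n)
      = ∑ n ∈ Finset.Ico 3 (N + 1), chi n * (Real.log n / n) := by
    symm
    apply Finset.sum_subset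
    · intro x; simp; omega
    · intro x hx hx2
      simp at hx hx2
      have : x = 1 ∨ x = 2 := by omega
      rcases this with rfl | rfl
      · simp
      · simp [chi_eq]
  rw [e]
  have he : Real.exp 1 ≤ 3 := (Real.exp_one_lt_d9.trans (by norm_num)).le
  by_cases hN : 3 ≤ N + 1
  · refine (aux_abel chi (fun n => Real.log n / n) 1 abs_sum_chi_le 3 (N + 1) hN ?_ ?_).trans ?_
    · intro i hi
      have hi' : (3 : ℝ) ≤ i := by exact_mod_cast hi
      apply Real.log_div_self_antitoneOn
      · simp only [Set.mem_Ici]; linarith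
      · simp only [Set.mem_Ici]; push_cast; linarith
      · push_cast; linarith
    · intro i hi
      have := Real.log_natCast_nonneg i
      positivity
    · have := Real.log_le_sub_one_of_pos (show (0 : ℝ) < 3 by norm_num)
      push_cast
      linarith
  · rw [Finset.Ico_eq_empty (by omega)]; simp

lemma exists_bound_chiLam : ∃ B : ℝ, ∀ N : ℕ, |∑ n ∈ Finset.Ioc 0 N, chiLam n| ≤ B := by
  have hL := Lval_one_pos
  refine ⟨(2 + 2 * (Real.log 4 + 4)) / Lval 1, fun N => ?_⟩
  rcases Nat.eq_zero_or_pos N with rfl | hN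
  · have := Real.log_nonneg (show (1 : ℝ) ≤ 4 by norm_num)
    simp; positivity
  have hNR : (0 : ℝ) < N := by exact_mod_cast hN
  rw [le_div_iff₀ hL]
  have h1 := ArithmeticFunction.sum_Ioc_mul_eq_sum_sum chiLam chiDiv N
  simp only [chiLam_mul_chiDiv, chiDiv_apply, ← Lpart_one_Ioc] at h1
  have h2 := abs_sum_chi_log N
  rw [h1] at h2
  have h3 : |∑ n ∈ Finset.Ioc 0 N, chiLam n * (Lval 1 - Lpart 1 (N / n + 1))|
      ≤ 2 * (Real.log 4 + 4) := by
    calc _ ≤ ∑ n ∈ Finset.Ioc 0 N, |chiLam n * (Lval 1 - Lpart 1 (N / n + 1))| :=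
          Finset.abs_sum_le_sum_abs _ _
      _ ≤ ∑ n ∈ Finset.Ioc 0 N, ArithmeticFunction.vonMangoldt n * (2 / N) := by
        refine Finset.sum_le_sum fun n hn => ?_
        have hn0 : (0 : ℝ) < n := by exact_mod_cast (Finset.mem_Ioc.1 hn).1
        have ha := Lval_tail 1 le_rfl (N / n + 1) (Nat.le_add_left 1 _)
        have hb : (2 : ℝ) / (N / n + 1 : ℕ) ≤ 2 * n / N := by
          have : (N : ℝ) / n ≤ (N / n + 1 : ℕ) := by
            have := (Nat.lt_floor_add_one ((N : ℝ) / n)).le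
            rw [Nat.floor_div_eq_div] at this
            exact_mod_cast this
          rw [div_le_div_iff₀ (by positivity) hNR]
          rw [div_le_iff₀ hn0] at this
          nlinarith
        have hL0 := ArithmeticFunction.vonMangoldt_nonneg (n := n)
        have hc : |chiLam n| ≤ ArithmeticFunction.vonMangoldt n / n := by
          rw [chiLam_apply, abs_div, abs_mul, abs_of_nonneg hL0, abs_of_pos hn0]
          gcongr
          have := abs_chi_le n
          nlinarith
        rw [abs_mul]
        calc _ ≤ ArithmeticFunction.vonMangoldt n / n * (2 * n / N) :=
              mul_le_mul hc (ha.trans hb) (abs_nonneg _) (by positivity)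
          _ = _ := by field_simp
      _ = Chebyshev.psi N * (2 / N) := by
        rw [Chebyshev.psi, Nat.floor_natCast, Finset.sum_mul]
      _ ≤ (Real.log 4 + 4) * N * (2 / N) := by
        gcongr
        exact Chebyshev.psi_le_const_mul_self hNR.le
      _ = _ := by field_simp
  have e : (∑ n ∈ Finset.Ioc 0 N, chiLam n) * Lval 1
      = ∑ n ∈ Finset.Ioc 0 N, chiLam n * Lpart 1 (N / n + 1)
        + ∑ n ∈ Finset.Ioc 0 N, chiLam n * (Lval 1 - Lpart 1 (N / n + 1)) := by
    rw [← Finset.sum_add_distrib, Finset.sum_mul]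
    exact Finset.sum_congr rfl fun _ _ => by ring
  have e2 : |∑ n ∈ Finset.Ioc 0 N, chiLam n| * Lval 1
      = |(∑ n ∈ Finset.Ioc 0 N, chiLam n) * Lval 1| := by
    rw [abs_mul, abs_of_pos hL]
  rw [e2, e]
  exact (abs_add_le _ _).trans (add_le_add h2 h3)

/-- `χ(p) log p / p` on primes, zero elsewhere. -/
def chiPrime (n : ℕ) : ℝ := if n.Prime then chi n * (Real.log n / n) else 0

lemma exists_bound_chiPrime : ∃ B : ℝ, ∀ N : ℕ, |∑ n ∈ Finset.range N, chiPrime n| ≤ B := by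
  obtain ⟨B, hB⟩ := exists_bound_chiLam
  have hs := ArithmeticFunction.vonMangoldt.summable_residueClass_non_primes_div (0 : ZMod 1)
  set g : ℕ → ℝ := fun n => (if n.Prime then 0 else
    ArithmeticFunction.vonMangoldt.residueClass (0 : ZMod 1) n) / n with hg
  have hgn (n : ℕ) : 0 ≤ g n := by
    have := ArithmeticFunction.vonMangoldt.residueClass_nonneg (0 : ZMod 1) n
    simp only [hg]; positivity
  have hgv (n : ℕ) (hn : ¬ n.Prime) : g n = ArithmeticFunction.vonMangoldt n / n := by
    simp only [hg, if_neg hn]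
    congr 1
    simp [ArithmeticFunction.vonMangoldt.residueClass, Subsingleton.elim _ (0 : ZMod 1)]
  refine ⟨B + ∑' n, g n, fun N => ?_⟩
  have h1 : |∑ n ∈ Finset.range N, chiLam n| ≤ B := by
    rcases N with _ | N
    · simpa using hB 0
    · convert hB N using 2
      rw [Finset.range_eq_Ico, Finset.sum_eq_sum_Ico_succ_bot (by omega)]
      simp only [ArithmeticFunction.map_zero, zero_add]
      refine Finset.sum_congr ?_ fun i _ => rfl
      ext; simp; omega
  have h2 : |∑ n ∈ Finset.range N, (chiPrime n - chiLam n)| ≤ ∑' n, g n := by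
    refine (Finset.abs_sum_le_sum_abs _ _).trans ?_
    refine le_trans (Finset.sum_le_sum fun n _ => ?_) (hs.sum_le_tsum (Finset.range N) fun n _ => hgn n)
    by_cases hn : n.Prime
    · have : chiPrime n - chiLam n = 0 := by
        rw [chiPrime, if_pos hn, chiLam_apply, ArithmeticFunction.vonMangoldt_apply_prime hn]; ring
      rw [this, abs_zero]; exact hgn n
    · change _ ≤ g n
      rw [hgv n hn, chiPrime, if_neg hn, chiLam_apply, zero_sub, abs_neg, abs_div, abs_mul,
        abs_of_nonneg ArithmeticFunction.vonMangoldt_nonneg, Nat.abs_cast]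
      gcongr
      have := abs_chi_le n
      have := ArithmeticFunction.vonMangoldt_nonneg (n := n)
      nlinarith
  have e : ∑ n ∈ Finset.range N, chiPrime n = ∑ n ∈ Finset.range N, chiLam n
      + ∑ n ∈ Finset.range N, (chiPrime n - chiLam n) := by
    rw [← Finset.sum_add_distrib]
    exact Finset.sum_congr rfl fun _ _ => by ring
  rw [e]
  exact (abs_add_le _ _).trans (add_le_add h1 h2)

/-! ## The Euler product at 1 -/

lemma exists_bound_primes : ∃ B : ℝ, ∀ s : ℝ, 1 ≤ s → ∀ M N : ℕ, 2 ≤ M → M ≤ N →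
    |∑ n ∈ Finset.Ico M N, (if n.Prime then chi n * (n : ℝ) ^ (-s) else 0)|
      ≤ 2 * B / Real.log M := by
  obtain ⟨B, hB⟩ := exists_bound_chiPrime
  have hB0 : 0 ≤ B := (abs_nonneg _).trans (hB 0)
  refine ⟨B, fun s hs M N hM hMN => ?_⟩
  have h := aux_abel chiPrime (fun n => (n : ℝ) ^ (1 - s) / Real.log n) B hB M N hMN
    (fun i hi => by
      have hi2 : (2 : ℝ) ≤ i := by exact_mod_cast hM.trans hi
      have hl : 0 < Real.log i := Real.log_pos (by linarith)
      apply div_le_div₀ (by positivity) _ hl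
      · exact Real.log_le_log (by linarith) (by push_cast; linarith)
      · apply Real.rpow_le_rpow_of_nonpos (by linarith) (by push_cast; linarith) (by linarith))
    (fun i hi => by
      have := Real.log_natCast_nonneg i
      positivity)
  have e : ∑ n ∈ Finset.Ico M N, (if n.Prime then chi n * (n : ℝ) ^ (-s) else 0)
      = ∑ i ∈ Finset.Ico M N, chiPrime i * ((i : ℝ) ^ (1 - s) / Real.log i) := by
    refine Finset.sum_congr rfl fun n hn => ?_
    unfold chiPrime
    split_ifs with hp
    · have hn2 : (2 : ℝ) ≤ n := by exact_mod_cast hp.two_le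
      have hl : 0 < Real.log n := Real.log_pos (by linarith)
      rw [Real.rpow_sub (by linarith), Real.rpow_one, Real.rpow_neg (by linarith)]
      field_simp
    · simp
  rw [e]
  refine h.trans ?_
  have hM2 : (2 : ℝ) ≤ M := by exact_mod_cast hM
  have hl : 0 < Real.log M := Real.log_pos (by linarith)
  have : (M : ℝ) ^ (1 - s) ≤ 1 := Real.rpow_le_one_of_one_le_of_nonpos (by linarith) (by linarith)
  calc 2 * B * ((M : ℝ) ^ (1 - s) / Real.log M) ≤ 2 * B * (1 / Real.log M) := by gcongr
    _ = _ := by ring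

lemma abs_chi_rpow_le (s : ℝ) (hs : 1 ≤ s) (n : ℕ) (hn : 1 ≤ n) :
    |chi n * (n : ℝ) ^ (-s)| ≤ (n : ℝ)⁻¹ := by
  rw [abs_mul, ← Real.rpow_neg_one, abs_of_nonneg (show 0 ≤ (n : ℝ) ^ (-s) by positivity)]
  have h1 : (n : ℝ) ^ (-s) ≤ (n : ℝ) ^ (-1 : ℝ) :=
    Real.rpow_le_rpow_of_exponent_le (by exact_mod_cast hn) (by linarith)
  have h2 := abs_chi_le n
  have h3 : 0 ≤ (n : ℝ) ^ (-s) := by positivity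
  nlinarith

/-- Log of the truncated Euler product. -/
def logE (s : ℝ) (N : ℕ) : ℝ :=
  ∑ n ∈ Finset.range N, if n.Prime then -Real.log (1 - chi n * (n : ℝ) ^ (-s)) else 0

lemma one_sub_pos_chi (s : ℝ) (hs : 1 ≤ s) (n : ℕ) (hn : 2 ≤ n) :
    0 < 1 - chi n * (n : ℝ) ^ (-s) := by
  have h := abs_chi_rpow_le s hs n (by omega)
  have hn2 : (2 : ℝ) ≤ n := by exact_mod_cast hn
  have : (n : ℝ)⁻¹ ≤ 2⁻¹ := inv_anti₀ (by norm_num) hn2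
  have := (abs_le.1 h).2
  linarith

lemma exp_logE (s : ℝ) (hs : 1 ≤ s) (N : ℕ) :
    Real.exp (logE s N) = ∏ p ∈ Nat.primesBelow N, (1 - chi p * (p : ℝ) ^ (-s))⁻¹ := by
  rw [logE, Real.exp_sum, Nat.primesBelow, Finset.prod_filter]
  refine Finset.prod_congr rfl fun n _ => ?_
  split_ifs with hp
  · rw [Real.exp_neg, Real.exp_log (one_sub_pos_chi s hs n hp.two_le)]
  · simp

lemma exists_bound_logE : ∃ δ : ℕ → ℝ, Tendsto δ atTop (nhds 0) ∧
    ∀ s : ℝ, 1 ≤ s → ∀ M N : ℕ, 2 ≤ M → M ≤ N → |logE s N - logE s M| ≤ δ M := by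
  obtain ⟨B, hB⟩ := exists_bound_primes
  refine ⟨fun M => 2 * B / Real.log M + 4 / M, ?_, fun s hs M N hM hMN => ?_⟩
  · have h1 : Tendsto (fun n : ℕ => 4 / (n : ℝ)) atTop (nhds 0) :=
      tendsto_const_div_atTop_nhds_zero_nat 4
    have h2 : Tendsto (fun n : ℕ => 2 * B / Real.log n) atTop (nhds 0) :=
      (Real.tendsto_log_atTop.comp tendsto_natCast_atTop_atTop).const_div_atTop (2 * B)
    simpa using h2.add h1
  have e : logE s N - logE s M
      = ∑ n ∈ Finset.Ico M N, (if n.Prime then chi n * (n : ℝ) ^ (-s) else 0)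
      + ∑ n ∈ Finset.Ico M N, (if n.Prime then
          -(chi n * (n : ℝ) ^ (-s) + Real.log (1 - chi n * (n : ℝ) ^ (-s))) else 0) := by
    rw [logE, logE, ← Finset.sum_Ico_eq_sub _ hMN, ← Finset.sum_add_distrib]
    refine Finset.sum_congr rfl fun n _ => ?_
    split_ifs <;> ring
  rw [e]
  refine (abs_add_le _ _).trans (add_le_add (hB s hs M N hM hMN) ?_)
  calc _ ≤ ∑ n ∈ Finset.Ico M N, |(if n.Prime then
          -(chi n * (n : ℝ) ^ (-s) + Real.log (1 - chi n * (n : ℝ) ^ (-s))) else 0)| :=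
        Finset.abs_sum_le_sum_abs _ _
    _ ≤ ∑ n ∈ Finset.Ico M N, 2 * ((n : ℝ) ^ 2)⁻¹ := by
      refine Finset.sum_le_sum fun n hn => ?_
      split_ifs with hp
      · have h := abs_chi_rpow_le s hs n hp.one_lt.le
        have hn2 : (2 : ℝ) ≤ n := by exact_mod_cast hp.two_le
        have h2 : (n : ℝ)⁻¹ ≤ 2⁻¹ := inv_anti₀ (by norm_num) hn2
        set x := chi n * (n : ℝ) ^ (-s)
        have hx : |x| ≤ 1 / 2 := by linarith
        have h3 := Real.abs_log_sub_add_sum_range_le (x := x) (by linarith) 1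
        simp at h3
        rw [abs_neg]
        refine h3.trans ?_
        rw [div_le_iff₀ (by linarith), ← inv_pow, ← sq_abs]
        have h4 : |x| ^ 2 ≤ ((n : ℝ)⁻¹) ^ 2 := by gcongr
        nlinarith [sq_nonneg ((n : ℝ)⁻¹)]
      · simp only [abs_zero]; positivity
    _ ≤ 4 / M := by
      rw [← Finset.mul_sum]
      have h := sum_Ioo_inv_sq_le (α := ℝ) (M - 1) N
      have e2 : Finset.Ioo (M - 1) N = Finset.Ico M N := by ext; simp; omega
      have e3 : ((M - 1 : ℕ) : ℝ) + 1 = M := by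
        rw [Nat.cast_sub (by omega)]; simp
      rw [e2, e3] at h
      calc _ ≤ 2 * (2 / (M : ℝ)) := by gcongr
        _ = _ := by ring

/-- The completely multiplicative function `χ(n) n^{-s}`. -/
def chiHom (s : ℝ) : ℕ →*₀ ℝ where
  toFun n := chi n * (n : ℝ) ^ (-s)
  map_zero' := by simp [chi_zero]
  map_one' := by simp [chi_one]
  map_mul' m n := by
    rw [chi_mul]; push_cast
    rw [Real.mul_rpow (by positivity) (by positivity)]; ring

lemma tendsto_euler (s : ℝ) (hs : 1 < s) :
    Tendsto (fun N => Real.exp (logE s N)) atTop (nhds (Lval s)) := by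
  have hsum : Summable (fun n => ‖chiHom s n‖) := by
    refine Summable.of_nonneg_of_le (fun n => norm_nonneg _) (fun n => ?_)
      (Real.summable_nat_rpow.2 (show -s < -1 by linarith))
    change |chi n * (n : ℝ) ^ (-s)| ≤ _
    rw [abs_mul, abs_of_nonneg (show 0 ≤ (n : ℝ) ^ (-s) by positivity)]
    have h3 : 0 ≤ (n : ℝ) ^ (-s) := by positivity
    have h2 := abs_chi_le n
    nlinarith
  have h := EulerProduct.eulerProduct_completely_multiplicative hsum
  have h2 : ∑' n, chiHom s n = Lval s :=
    tendsto_nhds_unique hsum.of_norm.hasSum.tendsto_sum_nat (Lval_tendsto s hs.le)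
  rw [h2] at h
  refine h.congr fun N => ?_
  rw [exp_logE s hs.le]
  rfl

lemma logE_continuousWithinAt (M : ℕ) : ContinuousWithinAt (fun s => logE s M) (Set.Ioi 1) 1 := by
  unfold logE
  refine ContinuousAt.continuousWithinAt ?_
  refine tendsto_finsetSum _ fun i _ => ?_
  split_ifs with hp
  · have hp0 : (i : ℝ) ≠ 0 := by exact_mod_cast hp.ne_zero
    have hc : Continuous fun s : ℝ => 1 - chi i * (i : ℝ) ^ (-s) :=
      continuous_const.sub (continuous_const.mul
        (Continuous.rpow continuous_const continuous_neg (fun s => Or.inl hp0)))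
    exact (hc.continuousAt.log (one_sub_pos_chi 1 le_rfl i hp.two_le).ne').neg
  · exact tendsto_const_nhds

lemma tendsto_euler_one : Tendsto (fun N => Real.exp (logE 1 N)) atTop (nhds (Lval 1)) := by
  obtain ⟨δ, hδ, hb⟩ := exists_bound_logE
  have hL : Tendsto Lval (nhdsWithin 1 (Set.Ioi 1)) (nhds (Lval 1)) :=
    (Lval_continuousOn 1 (by simp)).mono_left (nhdsWithin_mono _ Set.Ioi_subset_Ici_self)
  have hlog : Tendsto (fun s => Real.log (Lval s)) (nhdsWithin 1 (Set.Ioi 1))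
      (nhds (Real.log (Lval 1))) := hL.log Lval_one_pos.ne'
  have key : ∀ M : ℕ, 2 ≤ M → |Real.log (Lval 1) - logE 1 M| ≤ δ M := by
    intro M hM
    have h1 := (hlog.sub (logE_continuousWithinAt M)).abs
    refine le_of_tendsto h1 ?_
    filter_upwards [self_mem_nhdsWithin, hL.eventually (lt_mem_nhds Lval_one_pos)] with s hs hpos
    have h2 : Tendsto (fun N => logE s N) atTop (nhds (Real.log (Lval s))) := by
      simpa using (tendsto_euler s hs).log hpos.ne'
    refine le_of_tendsto ((h2.sub_const (logE s M)).abs) ?_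
    filter_upwards [eventually_ge_atTop M] with N hN
    exact hb s (le_of_lt hs) M N hM hN
  have h3 : Tendsto (fun M => logE 1 M) atTop (nhds (Real.log (Lval 1))) := by
    rw [tendsto_iff_dist_tendsto_zero]
    refine squeeze_zero' (Eventually.of_forall fun _ => dist_nonneg) ?_ hδ
    filter_upwards [eventually_ge_atTop 2] with M hM
    rw [dist_comm, Real.dist_eq]
    exact key M hM
  have h4 := (Real.continuous_exp.tendsto _).comp h3
  rw [Real.exp_log Lval_one_pos] at h4
  exact h4

/-! ## The arithmetic functions -/

open ArithmeticFunction in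
/-- `χ` as an arithmetic function. -/
def chiA : ArithmeticFunction ℝ := ⟨chi, chi_zero⟩

lemma chiA_apply (n : ℕ) : chiA n = chi n := rfl

/-- `f` as an arithmetic function. -/
def fA (S : Finset ℕ) : ArithmeticFunction ℝ := ⟨fSigma S, by simp [fSigma]⟩

lemma fA_apply (S : Finset ℕ) (n : ℕ) : fA S n = fSigma S n := rfl

/-- `μ χ`. -/
def muchi : ArithmeticFunction ℝ :=
  ArithmeticFunction.pmul (ArithmeticFunction.moebius : ArithmeticFunction ℝ) chiA

lemma chiA_mult : chiA.IsMultiplicative := by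
  refine ⟨chi_one, fun {m n} _ => chi_mul m n⟩

lemma fA_mult (S : Finset ℕ) : (fA S).IsMultiplicative := by
  refine ⟨?_, fun {m n} h => ?_⟩
  · rw [fA_apply, fSigma, if_pos]
    · simp
    · refine ⟨squarefree_one, fun p hp h => absurd (Nat.dvd_one.1 h) hp.one_lt.ne'⟩
  · simp only [fA_apply, fSigma]
    have hiff : (Squarefree (m * n) ∧
      ∀ p : ℕ, p.Prime → p ∣ m * n → ¬(p = 2 ∨ (p.Prime ∧ p % 4 = 3) ∨ p ∈ S)) ↔
      (Squarefree m ∧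
      ∀ p : ℕ, p.Prime → p ∣ m → ¬(p = 2 ∨ (p.Prime ∧ p % 4 = 3) ∨ p ∈ S)) ∧
      (Squarefree n ∧
      ∀ p : ℕ, p.Prime → p ∣ n → ¬(p = 2 ∨ (p.Prime ∧ p % 4 = 3) ∨ p ∈ S)) := by
      rw [Nat.squarefree_mul h]
      constructor
      · rintro ⟨⟨h1, h2⟩, h3⟩
        exact ⟨⟨h1, fun p hp hd => h3 p hp (hd.mul_right _)⟩,
          ⟨h2, fun p hp hd => h3 p hp (hd.mul_left _)⟩⟩
      · rintro ⟨⟨h1, h3⟩, ⟨h2, h4⟩⟩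
        refine ⟨⟨h1, h2⟩, fun p hp hd => ?_⟩
        rcases hp.dvd_mul.1 hd with hd | hd
        · exact h3 p hp hd
        · exact h4 p hp hd
    by_cases hm : (Squarefree m ∧
      ∀ p : ℕ, p.Prime → p ∣ m → ¬(p = 2 ∨ (p.Prime ∧ p % 4 = 3) ∨ p ∈ S))
    · by_cases hn : (Squarefree n ∧
        ∀ p : ℕ, p.Prime → p ∣ n → ¬(p = 2 ∨ (p.Prime ∧ p % 4 = 3) ∨ p ∈ S))
      · rw [if_pos (hiff.2 ⟨hm, hn⟩), if_pos hm, if_pos hn, h.primeFactors_mul,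
          Finset.card_union_of_disjoint h.disjoint_primeFactors, pow_add]
      · rw [if_neg (fun h => hn (hiff.1 h).2), if_neg hn, mul_zero]
    · rw [if_neg (fun h => hm (hiff.1 h).1), if_neg hm, zero_mul]

lemma muchi_mult : muchi.IsMultiplicative :=
  ArithmeticFunction.isMultiplicative_moebius.intCast.pmul chiA_mult

lemma muchi_mul_chiA : muchi * chiA = 1 := by
  have h := @ArithmeticFunction.coe_moebius_mul_coe_zeta ℝ _
  ext n
  have hn := congrArg (fun f => chi n * f n) h
  simp only [ArithmeticFunction.mul_apply, Finset.mul_sum] at hn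
  rw [ArithmeticFunction.mul_apply]
  trans (chi n * (1 : ArithmeticFunction ℝ) n)
  · rw [← hn]
    refine Finset.sum_congr rfl fun x hx => ?_
    obtain ⟨hx1, hx2⟩ := Nat.mem_divisorsAntidiagonal.1 hx
    have h2 : x.2 ≠ 0 := by
      rintro h; apply hx2; rw [← hx1]; simp [h]
    rw [← hx1, chi_mul, muchi, ArithmeticFunction.pmul_apply, chiA_apply, chiA_apply,
      ArithmeticFunction.natCoe_apply, ArithmeticFunction.zeta_apply_ne h2]
    push_cast; ring
  · by_cases h1 : n = 1
    · simp [h1, chi_one]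
    · simp [h1]

/-- The convolution factor `h`. -/
def hA (S : Finset ℕ) : ArithmeticFunction ℝ :=
  fA S * ((ArithmeticFunction.moebius : ArithmeticFunction ℝ) * muchi)

lemma hA_mult (S : Finset ℕ) : (hA S).IsMultiplicative :=
  (fA_mult S).mul (ArithmeticFunction.isMultiplicative_moebius.intCast.mul muchi_mult)

lemma fA_eq (S : Finset ℕ) :
    fA S = hA S * (chiA * (ArithmeticFunction.zeta : ArithmeticFunction ℝ)) := by
  have h := @ArithmeticFunction.coe_moebius_mul_coe_zeta ℝ _
  calc fA S = fA S * ((ArithmeticFunction.moebius : ArithmeticFunction ℝ) *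
      (ArithmeticFunction.zeta : ArithmeticFunction ℝ)) * (muchi * chiA) := by
        rw [h, muchi_mul_chiA, mul_one, mul_one]
    _ = _ := by rw [hA]; ring

lemma conv_prime_pow (a b : ArithmeticFunction ℝ) (ha1 : a 1 = 1) (p : ℕ) (hp : p.Prime)
    (ha : ∀ i, 2 ≤ i → a (p ^ i) = 0) (k : ℕ) :
    (a * b) (p ^ (k + 1)) = b (p ^ (k + 1)) + a p * b (p ^ k) := by
  rw [ArithmeticFunction.mul_apply, Nat.sum_divisorsAntidiagonal (fun x y => a x * b y),
    Nat.sum_divisors_prime_pow hp, Finset.sum_range_succ', Finset.sum_range_succ']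
  rw [Finset.sum_eq_zero fun i _ => by rw [ha (i + 1 + 1) (by omega), zero_mul]]
  have : p ^ (k + 1) / p = p ^ k := by
    rw [pow_succ, Nat.mul_div_cancel _ hp.pos]
  simp [ha1, this]
  ring

lemma moebius_pow (p : ℕ) (hp : p.Prime) (i : ℕ) (hi : 2 ≤ i) :
    (ArithmeticFunction.moebius : ArithmeticFunction ℝ) (p ^ i) = 0 := by
  rw [ArithmeticFunction.intCoe_apply, ArithmeticFunction.moebius_apply_prime_pow hp (by omega),
    if_neg (by omega)]
  simp

lemma muchi_pow (p : ℕ) (hp : p.Prime) (i : ℕ) (hi : 2 ≤ i) : muchi (p ^ i) = 0 := by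
  rw [muchi, ArithmeticFunction.pmul_apply, moebius_pow p hp i hi, zero_mul]

lemma muchi_prime (p : ℕ) (hp : p.Prime) : muchi p = - chi p := by
  rw [muchi, ArithmeticFunction.pmul_apply, ArithmeticFunction.intCoe_apply,
    ArithmeticFunction.moebius_apply_prime hp, chiA_apply]
  simp

lemma fA_pow (S : Finset ℕ) (p : ℕ) (hp : p.Prime) (i : ℕ) (hi : 2 ≤ i) : fA S (p ^ i) = 0 := by
  rw [fA_apply, fSigma, if_neg]
  rintro ⟨h, -⟩
  rw [Nat.squarefree_pow_iff hp.ne_one (by omega)] at h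
  omega

lemma fA_prime (S : Finset ℕ) (p : ℕ) (hp : p.Prime) :
    fSigma S p = if (p = 2 ∨ p % 4 = 3 ∨ p ∈ S) then 0 else 2 := by
  rw [fSigma]
  by_cases h : p = 2 ∨ p % 4 = 3 ∨ p ∈ S
  · rw [if_pos h, if_neg]
    rintro ⟨-, h2⟩
    have := h2 p hp dvd_rfl
    tauto
  · rw [if_neg h, if_pos]
    · simp [hp.primeFactors]
    · refine ⟨hp.prime.squarefree, fun q hq hqp => ?_⟩
      rw [(Nat.prime_dvd_prime_iff_eq hq hp).1 hqp]
      tauto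

lemma moebius_real_prime (p : ℕ) (hp : p.Prime) :
    (ArithmeticFunction.moebius : ArithmeticFunction ℝ) p = -1 := by
  rw [ArithmeticFunction.intCoe_apply, ArithmeticFunction.moebius_apply_prime hp]; simp

lemma gA_pow (p : ℕ) (hp : p.Prime) (k : ℕ) :
    ((ArithmeticFunction.moebius : ArithmeticFunction ℝ) * muchi) (p ^ (k + 1))
      = muchi (p ^ (k + 1)) - muchi (p ^ k) := by
  rw [conv_prime_pow _ _ (by simp) p hp (moebius_pow p hp), moebius_real_prime p hp]
  ring

lemma gA_one : ((ArithmeticFunction.moebius : ArithmeticFunction ℝ) * muchi) 1 = 1 :=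
  (ArithmeticFunction.isMultiplicative_moebius.intCast.mul muchi_mult).1

lemma hA_p1 (S : Finset ℕ) (p : ℕ) (hp : p.Prime) :
    hA S p = fSigma S p - 1 - chi p := by
  have h := conv_prime_pow (fA S) ((ArithmeticFunction.moebius : ArithmeticFunction ℝ) * muchi)
    (fA_mult S).1 p hp (fA_pow S p hp) 0
  rw [gA_pow p hp, pow_zero, zero_add, pow_one, gA_one, muchi_prime p hp, muchi_mult.1,
    fA_apply] at h
  rw [hA, h]; ring

lemma hA_p2 (S : Finset ℕ) (p : ℕ) (hp : p.Prime) :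
    hA S (p ^ 2) = chi p - fSigma S p * (1 + chi p) := by
  have h := conv_prime_pow (fA S) ((ArithmeticFunction.moebius : ArithmeticFunction ℝ) * muchi)
    (fA_mult S).1 p hp (fA_pow S p hp) 1
  rw [gA_pow p hp, show p ^ 1 = p ^ (0 + 1) by simp, gA_pow p hp, muchi_pow p hp _ (by norm_num),
    zero_add, pow_one, pow_zero, muchi_prime p hp, muchi_mult.1, fA_apply] at h
  rw [hA, h]; ring

lemma hA_p3 (S : Finset ℕ) (p : ℕ) (hp : p.Prime) :
    hA S (p ^ 3) = fSigma S p * chi p := by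
  have h := conv_prime_pow (fA S) ((ArithmeticFunction.moebius : ArithmeticFunction ℝ) * muchi)
    (fA_mult S).1 p hp (fA_pow S p hp) 2
  rw [gA_pow p hp, show p ^ 2 = p ^ (1 + 1) by simp, gA_pow p hp, muchi_pow p hp _ (by norm_num),
    muchi_pow p hp _ (by norm_num), pow_one, muchi_prime p hp, fA_apply] at h
  rw [hA, h]; ring

lemma hA_p4 (S : Finset ℕ) (p : ℕ) (hp : p.Prime) (k : ℕ) (hk : 4 ≤ k) :
    hA S (p ^ k) = 0 := by
  obtain ⟨j, rfl⟩ := Nat.exists_eq_add_of_le hk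
  have h := conv_prime_pow (fA S) ((ArithmeticFunction.moebius : ArithmeticFunction ℝ) * muchi)
    (fA_mult S).1 p hp (fA_pow S p hp) (j + 2 + 1)
  rw [gA_pow p hp, gA_pow p hp, muchi_pow p hp _ (by omega), muchi_pow p hp _ (by omega),
    muchi_pow p hp _ (by omega)] at h
  rw [hA, show 4 + j = j + 2 + 1 + 1 by ring, h]; ring

lemma fSigma_prime_bound (S : Finset ℕ) (p : ℕ) (hp : p.Prime) :
    0 ≤ fSigma S p ∧ fSigma S p ≤ 2 := by
  rw [fA_prime S p hp]; split_ifs <;> norm_num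

lemma hA_p1_zero (S : Finset ℕ) (p : ℕ) (hp : p.Prime) (h : p ∉ insert 2 S) :
    hA S p = 0 := by
  rw [hA_p1 S p hp, fA_prime S p hp, chi_eq]
  simp at h
  have h2 := hp.eq_two_or_odd
  have h3 : p % 2 = 1 := by tauto
  have h4 : p % 4 = 1 ∨ p % 4 = 3 := by omega
  rcases h4 with h4 | h4
  · simp [h, h3, h4]; norm_num
  · simp [h3, h4]

lemma abs_hA_p1 (S : Finset ℕ) (p : ℕ) (hp : p.Prime) : |hA S p| ≤ 5 := by
  have h1 := fSigma_prime_bound S p hp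
  have h2 := abs_le.1 (abs_chi_le p)
  rw [hA_p1 S p hp, abs_le]; constructor <;> linarith [h1.1, h1.2, h2.1, h2.2]

lemma abs_hA_p2 (S : Finset ℕ) (p : ℕ) (hp : p.Prime) : |hA S (p ^ 2)| ≤ 5 := by
  have h1 := fSigma_prime_bound S p hp
  have h2 := abs_le.1 (abs_chi_le p)
  rw [hA_p2 S p hp, abs_le]; constructor <;> nlinarith [h1.1, h1.2, h2.1, h2.2]

lemma abs_hA_p3 (S : Finset ℕ) (p : ℕ) (hp : p.Prime) : |hA S (p ^ 3)| ≤ 5 := by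
  have h1 := fSigma_prime_bound S p hp
  have h2 := abs_le.1 (abs_chi_le p)
  rw [hA_p3 S p hp, abs_le]; constructor <;> nlinarith [h1.1, h1.2, h2.1, h2.2]

/-! ## Absolute convergence for `h` -/

lemma summable_hA (S : Finset ℕ) : Summable (fun n : ℕ => |hA S n| * (n : ℝ) ^ (-(3 / 4) : ℝ)) := by
  set u : ℕ → ℝ := fun n => |hA S n| * (n : ℝ) ^ (-(3 / 4) : ℝ) with hu
  have hu0 (n : ℕ) : 0 ≤ u n := by simp only [hu]; positivity
  have hu00 : u 0 = 0 := by simp [hu]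
  have hu1 : u 1 = 1 := by simp [hu, (hA_mult S).1]
  have humul : ∀ {m n : ℕ}, Nat.Coprime m n → u (m * n) = u m * u n := by
    intro m n h
    simp only [hu]
    rw [(hA_mult S).2 h, abs_mul]; push_cast
    rw [Real.mul_rpow (by positivity) (by positivity)]; ring
  have hu4 (p : ℕ) (hp : p.Prime) (k : ℕ) (hk : k ∉ Finset.range 4) : u (p ^ k) = 0 := by
    simp only [hu]
    rw [hA_p4 S p hp k (by simpa using hk)]; simp
  have hsum : ∀ {p : ℕ}, p.Prime → Summable (fun n : ℕ ↦ ‖u (p ^ n)‖) := by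
    intro p hp
    exact summable_of_ne_finset_zero (s := Finset.range 4) fun k hk => by rw [hu4 p hp k hk, norm_zero]
  set c : ℕ → ℝ := fun n => (if n ∈ insert 2 S then 5 else 0) + 10 * (n : ℝ) ^ (-(3 / 2) : ℝ) with hc
  have hc0 (n : ℕ) : 0 ≤ c n := by
    simp only [hc]; split_ifs <;> positivity
  have hcs : Summable c := by
    refine Summable.add ?_ ((Real.summable_nat_rpow.2 (by norm_num)).mul_left 10)
    exact summable_of_ne_finset_zero (s := insert 2 S) fun k hk => by rw [if_neg hk]
  have hfac (p : ℕ) (hp : p.Prime) : ∑' k, u (p ^ k) ≤ 1 + c p := by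
    rw [tsum_eq_sum (s := Finset.range 4) (hu4 p hp)]
    simp only [Finset.sum_range_succ, Finset.sum_range_zero, pow_zero, pow_one, hu1, zero_add]
    have hp1 : (1 : ℝ) ≤ p := by exact_mod_cast hp.one_lt.le
    have t1 : u p ≤ if p ∈ insert 2 S then 5 else 0 := by
      simp only [hu]
      split_ifs with h
      · have : (p : ℝ) ^ (-(3 / 4) : ℝ) ≤ 1 :=
          Real.rpow_le_one_of_one_le_of_nonpos hp1 (by norm_num)
        have h0 : 0 ≤ (p : ℝ) ^ (-(3 / 4) : ℝ) := by positivity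
        nlinarith [abs_hA_p1 S p hp, abs_nonneg (hA S p)]
      · rw [hA_p1_zero S p hp h]; simp
    have t2 : u (p ^ 2) ≤ 5 * (p : ℝ) ^ (-(3 / 2) : ℝ) := by
      simp only [hu]
      have : ((p ^ 2 : ℕ) : ℝ) ^ (-(3 / 4) : ℝ) = (p : ℝ) ^ (-(3 / 2) : ℝ) := by
        push_cast
        rw [← Real.rpow_natCast, ← Real.rpow_mul (by positivity)]; norm_num
      rw [this]
      have := abs_hA_p2 S p hp
      gcongr
    have t3 : u (p ^ 3) ≤ 5 * (p : ℝ) ^ (-(3 / 2) : ℝ) := by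
      simp only [hu]
      have : ((p ^ 3 : ℕ) : ℝ) ^ (-(3 / 4) : ℝ) ≤ (p : ℝ) ^ (-(3 / 2) : ℝ) := by
        push_cast
        rw [← Real.rpow_natCast, ← Real.rpow_mul (by positivity)]
        exact Real.rpow_le_rpow_of_exponent_le hp1 (by norm_num)
      have := abs_hA_p3 S p hp
      gcongr
    simp only [hc]
    linarith
  refine summable_of_sum_range_le (c := Real.exp (∑' n, c n)) hu0 fun N => ?_
  have h := (EulerProduct.summable_and_hasSum_smoothNumbers_prod_primesBelow_tsum hu1 humul hsum N).2
  have h' := hasSum_subtype_iff_indicator (f := u) (s := N.smoothNumbers) |>.1 h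
  calc ∑ i ∈ Finset.range N, u i = ∑ i ∈ Finset.range N, (N.smoothNumbers.indicator u) i := by
        refine Finset.sum_congr rfl fun i hi => ?_
        rcases Nat.eq_zero_or_pos i with rfl | hpos
        · rw [hu00, eq_comm]
          exact Set.indicator_apply_eq_zero.2 fun _ => hu00
        · rw [Set.indicator_of_mem]
          exact Nat.mem_smoothNumbers_of_lt hpos (Finset.mem_range.1 hi)
    _ ≤ ∏ p ∈ N.primesBelow, ∑' n : ℕ, u (p ^ n) :=
        sum_le_hasSum _ (fun i _ => Set.indicator_nonneg (fun x _ => hu0 x) i) h'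
    _ ≤ ∏ p ∈ N.primesBelow, Real.exp (c p) := by
        refine Finset.prod_le_prod (fun p _ => tsum_nonneg fun k => hu0 _) fun p hp => ?_
        refine (hfac p (Nat.prime_of_mem_primesBelow hp)).trans ?_
        linarith [Real.add_one_le_exp (c p)]
    _ = Real.exp (∑ p ∈ N.primesBelow, c p) := (Real.exp_sum _ _).symm
    _ ≤ _ := Real.exp_le_exp.2 (hcs.sum_le_tsum _ fun n _ => hc0 n)

lemma summable_hA_div (S : Finset ℕ) : Summable (fun n : ℕ => ‖hA S n / n‖) := by
  refine Summable.of_nonneg_of_le (fun _ => norm_nonneg _) (fun n => ?_) (summable_hA S)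
  rcases Nat.eq_zero_or_pos n with rfl | hn
  · simp
  · rw [norm_div, Real.norm_eq_abs, Real.norm_natCast, div_eq_mul_inv, ← Real.rpow_neg_one]
    have : (1 : ℝ) ≤ n := by exact_mod_cast hn
    exact mul_le_mul_of_nonneg_left (Real.rpow_le_rpow_of_exponent_le this (by norm_num))
      (abs_nonneg _)

lemma euler_hA (S : Finset ℕ) : Tendsto (fun N : ℕ => ∏ p ∈ Nat.primesBelow N,
    ((1 + fSigma S p / p) * (1 - 1 / (p : ℝ)) * (1 - chi p * (p : ℝ) ^ (-1 : ℝ))))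
    atTop (nhds (∑' n : ℕ, hA S n / n)) := by
  have h := EulerProduct.eulerProduct (f := fun n : ℕ => hA S n / n) (by simp [(hA_mult S).1])
    (by
      intro m n h
      rw [(hA_mult S).2 h]; push_cast
      rw [mul_div_mul_comm]) (summable_hA_div S) (by simp)
  refine h.congr fun N => Finset.prod_congr rfl fun p hp => ?_
  have hp := Nat.prime_of_mem_primesBelow hp
  have hp0 : (p : ℝ) ≠ 0 := by exact_mod_cast hp.ne_zero
  rw [tsum_eq_sum (s := Finset.range 4)
    (fun k hk => by rw [hA_p4 S p hp k (by simpa using hk)]; simp)]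
  simp only [Finset.sum_range_succ, Finset.sum_range_zero, pow_zero, pow_one,
    hA_p1 S p hp, hA_p2 S p hp, hA_p3 S p hp, (hA_mult S).1, Real.rpow_neg_one]
  push_cast
  field_simp
  ring

lemma tendsto_C (S : Finset ℕ) : Tendsto (fun T : ℕ =>
      ∏ p ∈ (Finset.range (T + 1)).filter Nat.Prime,
        (1 + fSigma S p / p) * (1 - 1 / (p : ℝ)))
      atTop (nhds ((∑' n : ℕ, hA S n / n) * Lval 1)) := by
  have h := ((euler_hA S).mul tendsto_euler_one).comp (tendsto_add_atTop_nat 1)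
  refine h.congr fun T => ?_
  simp only [Function.comp]
  rw [exp_logE 1 le_rfl, ← Finset.prod_mul_distrib]
  refine Finset.prod_congr rfl fun p hp => ?_
  have hp := Nat.prime_of_mem_primesBelow hp
  rw [mul_assoc, mul_inv_cancel₀ (one_sub_pos_chi 1 le_rfl p hp.two_le).ne', mul_one]

/-! ## Summatory function of `χ * 1` -/

/-- Summatory function of `r = χ * 1`. -/
def Rsum (N : ℕ) : ℝ :=
  ∑ n ∈ Finset.Ioc 0 N, (chiA * (ArithmeticFunction.zeta : ArithmeticFunction ℝ)) n

lemma Rsum_bound (N : ℕ) : |Rsum N - Lval 1 * N| ≤ 7 * Real.sqrt N := by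
  rcases Nat.eq_zero_or_pos N with rfl | hN
  · simp [Rsum]
  set D := Nat.sqrt N with hD
  have hD1 : 1 ≤ D := Nat.sqrt_pos.2 hN
  have hDN : D ≤ N := Nat.sqrt_le_self N
  have hlt : N < (D + 1) * (D + 1) := Nat.lt_succ_sqrt N
  have hDs : (D : ℝ) ≤ Real.sqrt N := Real.nat_sqrt_le_real_sqrt
  have e0 : Rsum N = ∑ d ∈ Finset.Ioc 0 D, chi d * ((N / d : ℕ) : ℝ)
      + ∑ d ∈ Finset.Ico (D + 1) (N + 1), chi d * ((N / d : ℕ) : ℝ) := by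
    rw [Rsum, ArithmeticFunction.sum_Ioc_mul_zeta_eq_sum]
    have : Finset.Ico (D + 1) (N + 1) = Finset.Ioc D N := by ext; simp
    rw [this, Finset.sum_Ioc_consecutive _ (Nat.zero_le D) hDN]
    rfl
  have h2 : |∑ d ∈ Finset.Ico (D + 1) (N + 1), chi d * ((N / d : ℕ) : ℝ)| ≤ 2 * D := by
    refine (aux_abel chi (fun d => ((N / d : ℕ) : ℝ)) 1 abs_sum_chi_le (D + 1) (N + 1)
      (by omega) ?_ ?_).trans ?_
    · intro i hi
      exact_mod_cast Nat.div_le_div_left (by omega) (by omega)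
    · intro i _; positivity
    · have : N / (D + 1) ≤ D := Nat.lt_succ_iff.1 (Nat.div_lt_of_lt_mul hlt)
      have : ((N / (D + 1) : ℕ) : ℝ) ≤ D := by exact_mod_cast this
      linarith
  have h1 : |∑ d ∈ Finset.Ioc 0 D, chi d * ((N / d : ℕ) : ℝ) - N * Lpart 1 (D + 1)| ≤ D := by
    rw [Lpart_one_Ioc, Finset.mul_sum, ← Finset.sum_sub_distrib]
    refine (Finset.abs_sum_le_sum_abs _ _).trans ?_
    calc _ ≤ ∑ d ∈ Finset.Ioc 0 D, (1 : ℝ) := by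
          refine Finset.sum_le_sum fun d hd => ?_
          have hd0 : (0 : ℝ) < d := by exact_mod_cast (Finset.mem_Ioc.1 hd).1
          have ha := Nat.lt_floor_add_one ((N : ℝ) / d)
          have hb := Nat.floor_le (show (0 : ℝ) ≤ (N : ℝ) / d by positivity)
          rw [Nat.floor_div_eq_div] at ha hb
          have e : chi d * ((N / d : ℕ) : ℝ) - N * (chi d / d)
              = chi d * (((N / d : ℕ) : ℝ) - (N : ℝ) / d) := by ring
          rw [e, abs_mul]
          have hc : |((N / d : ℕ) : ℝ) - (N : ℝ) / d| ≤ 1 := by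
            rw [abs_le]; constructor <;> linarith
          have := abs_chi_le d
          nlinarith [abs_nonneg (chi d), abs_nonneg (((N / d : ℕ) : ℝ) - (N : ℝ) / d)]
      _ = D := by simp
  have h3 : |N * Lpart 1 (D + 1) - Lval 1 * N| ≤ 2 * (D + 1) := by
    have h := Lval_tail 1 le_rfl (D + 1) (by omega)
    have e : N * Lpart 1 (D + 1) - Lval 1 * N = - (N * (Lval 1 - Lpart 1 (D + 1))) := by ring
    rw [e, abs_neg, abs_mul, Nat.abs_cast]
    have hltR : (N : ℝ) ≤ (D + 1) * (D + 1) := by exact_mod_cast hlt.le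
    calc (N : ℝ) * |Lval 1 - Lpart 1 (D + 1)| ≤ ((D + 1) * (D + 1)) * (2 / (D + 1 : ℕ)) := by
          gcongr
      _ = _ := by push_cast; field_simp
  have hD1R : (1 : ℝ) ≤ D := by exact_mod_cast hD1
  rw [e0]
  rw [abs_le] at *
  constructor <;> linarith [h1.1, h1.2, h2.1, h2.2, h3.1, h3.2]

lemma Rsum_bound_real (x : ℝ) (hx : 0 < x) :
    |Rsum ⌊x⌋₊ - Lval 1 * x| ≤ 8 * x ^ (3 / 4 : ℝ) := by
  have hL1 : Lval 1 ≤ 1 := by rw [Lval_one]; linarith [Real.pi_le_four]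
  have hL0 := Lval_one_pos
  by_cases h1 : 1 ≤ x
  · have ha := Rsum_bound ⌊x⌋₊
    have hb := Nat.floor_le hx.le
    have hc := Nat.lt_floor_add_one x
    have hs : Real.sqrt ⌊x⌋₊ ≤ x ^ (3 / 4 : ℝ) := by
      refine (Real.sqrt_le_sqrt hb).trans ?_
      rw [Real.sqrt_eq_rpow]
      exact Real.rpow_le_rpow_of_exponent_le h1 (by norm_num)
    have h1' : 1 ≤ x ^ (3 / 4 : ℝ) := Real.one_le_rpow h1 (by norm_num)
    rw [abs_le] at *
    constructor <;> nlinarith [ha.1, ha.2]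
  · push Not at h1
    rw [Nat.floor_eq_zero.2 h1]
    have e : Rsum 0 = 0 := by simp [Rsum]
    have : x ≤ x ^ (3 / 4 : ℝ) := by
      conv_lhs => rw [← Real.rpow_one x]
      exact Real.rpow_le_rpow_of_exponent_ge hx h1.le (by norm_num)
    rw [e, zero_sub, abs_neg, abs_of_pos (by positivity)]
    nlinarith

lemma main_bound (S : Finset ℕ) (Y : ℝ) (hY : 0 < Y) :
    |(∑ n ∈ Finset.Icc 1 ⌊Y⌋₊, fSigma S n) - ((∑' n : ℕ, hA S n / n) * Lval 1) * Y|
      ≤ (8 * ∑' n : ℕ, |hA S n| * (n : ℝ) ^ (-(3 / 4) : ℝ)) * Y ^ (3 / 4 : ℝ) := by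
  set N := ⌊Y⌋₊ with hN
  have e1 : ∑ n ∈ Finset.Icc 1 N, fSigma S n = ∑ d ∈ Finset.Ioc 0 N, hA S d * Rsum (N / d) := by
    have h := ArithmeticFunction.sum_Ioc_mul_eq_sum_sum (hA S)
      (chiA * (ArithmeticFunction.zeta : ArithmeticFunction ℝ)) N
    rw [← fA_eq] at h
    have hI : Finset.Icc 1 N = Finset.Ioc 0 N := by ext; simp; omega
    rw [hI]
    exact h
  have hz : ∀ d ∉ Finset.Ioc 0 N, hA S d * Rsum (N / d) = 0 := by
    intro d hd
    rcases Nat.eq_zero_or_pos d with rfl | hpos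
    · simp
    · have : N < d := by simp at hd; omega
      rw [Nat.div_eq_of_lt this]; simp [Rsum]
  have hs1 : Summable (fun d => hA S d * Rsum (N / d)) := summable_of_ne_finset_zero hz
  have hs2 : Summable (fun d : ℕ => hA S d / d * (Lval 1 * Y)) :=
    (summable_hA_div S).of_norm.mul_right _
  have e2 : ∑' d, hA S d * Rsum (N / d) = ∑ d ∈ Finset.Ioc 0 N, hA S d * Rsum (N / d) :=
    tsum_eq_sum hz
  rw [e1, ← e2, mul_assoc, ← tsum_mul_right, ← hs1.tsum_sub hs2, ← Real.norm_eq_abs]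
  have hs3 := ((summable_hA S).mul_left 8).mul_right (Y ^ (3 / 4 : ℝ))
  rw [← tsum_mul_left, ← tsum_mul_right]
  refine tsum_of_norm_bounded hs3.hasSum fun d => ?_
  rcases Nat.eq_zero_or_pos d with rfl | hpos
  · simp
  have hd0 : (0 : ℝ) < d := by exact_mod_cast hpos
  have h := Rsum_bound_real (Y / d) (by positivity)
  rw [Nat.floor_div_natCast, Real.div_rpow hY.le hd0.le] at h
  have e : hA S d * Rsum (N / d) - hA S d / d * (Lval 1 * Y)
      = hA S d * (Rsum (N / d) - Lval 1 * (Y / d)) := by ring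
  rw [e, Real.norm_eq_abs, abs_mul, Real.rpow_neg hd0.le]
  calc _ ≤ |hA S d| * (8 * (Y ^ (3 / 4 : ℝ) / (d : ℝ) ^ (3 / 4 : ℝ))) :=
        mul_le_mul_of_nonneg_left h (abs_nonneg _)
    _ = _ := by ring

/-- For `S` a finite set of primes `≡ 1 mod 4`, the Euler-product limit
`C = lim_{T→∞} ∏_{p ≤ T} (1 + f(p)/p)(1 − 1/p)` exists and, for every `0 < ε < 1`,
`∑_{1 ≤ n ≤ Y} f(n) = C·Y + O(Y/(log Y)^{1−ε})` as `Y → ∞`. -/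
theorem stmt9 (S : Finset ℕ) (hS : ∀ p ∈ S, p.Prime ∧ p % 4 = 1) :
    ∃ C : ℝ,
      Tendsto (fun T : ℕ =>
          ∏ p ∈ (Finset.range (T + 1)).filter Nat.Prime,
            (1 + fSigma S p / p) * (1 - 1 / (p : ℝ)))
        atTop (nhds C) ∧
      ∀ ε : ℝ, 0 < ε → ε < 1 →
        (fun Y : ℝ => (∑ n ∈ Finset.Icc 1 ⌊Y⌋₊, fSigma S n) - C * Y)
          =O[atTop] fun Y : ℝ => Y / Real.log Y ^ (1 - ε) := by
  refine ⟨_, tendsto_C S, fun ε _ _ => ?_⟩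
  have h1 : (fun Y : ℝ => (∑ n ∈ Finset.Icc 1 ⌊Y⌋₊, fSigma S n)
      - ((∑' n : ℕ, hA S n / n) * Lval 1) * Y) =O[atTop] fun Y : ℝ => Y ^ (3 / 4 : ℝ) := by
    refine IsBigO.of_bound (8 * ∑' n : ℕ, |hA S n| * (n : ℝ) ^ (-(3 / 4) : ℝ)) ?_
    filter_upwards [eventually_gt_atTop 0] with Y hY
    rw [Real.norm_eq_abs, Real.norm_eq_abs, abs_of_nonneg (show 0 ≤ Y ^ (3 / 4 : ℝ) by positivity)]
    exact main_bound S Y hY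
  refine h1.trans ?_
  have h2 := (isLittleO_log_rpow_rpow_atTop (1 - ε) (show (0 : ℝ) < 1 / 4 by norm_num)).bound
    (show (0 : ℝ) < 1 by norm_num)
  refine IsBigO.of_bound 1 ?_
  filter_upwards [h2, eventually_gt_atTop 1] with Y hY hY1
  have hl : 0 < Real.log Y := Real.log_pos hY1
  have hY0 : 0 < Y := by linarith
  have hl' : 0 < Real.log Y ^ (1 - ε) := by positivity
  rw [Real.norm_of_nonneg (by positivity), Real.norm_of_nonneg (by positivity), one_mul] at hY ⊢
  rw [le_div_iff₀ hl']
  calc Y ^ (3 / 4 : ℝ) * Real.log Y ^ (1 - ε) ≤ Y ^ (3 / 4 : ℝ) * Y ^ (1 / 4 : ℝ) := by gcongr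
    _ = Y := by rw [← Real.rpow_add hY0]; norm_num
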